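/- 12 ∫_ℝ (log(1+x²))² (1 − x²)² / (1+x²)⁴ dx = −(29/6)π + π³ + π · (log 4) · (log 64 − 7). Equivalently, for f(x) = log(1+x²), 3 ∫_ℝ f(x)² (f″(x))² dx equals this value, where f″(x) = 2(1−x²)/(1+x²)². -/

import Mathlib

open Real Set Filter Topology MeasureTheory

lemma aux_u (x : ℝ) : (1:ℝ) ≤ 1 + x ^ 2 := by nlinarith [sq_nonneg x]
lemma aux_L (x : ℝ) : 0 ≤ Real.log (1 + x ^ 2) := Real.log_nonneg (aux_u x)

lemma aux_cont : Continuous fun x : ℝ => Real.log (1 + x ^ 2) := by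
  apply Continuous.log (by fun_prop)
  intro x; have := aux_u x; linarith

lemma int0 : Integrable fun x : ℝ => 1 / (1 + x ^ 2) := by
  simpa using integrable_inv_one_add_sq

lemma int2 : Integrable fun x : ℝ => (Real.log (1 + x ^ 2)) ^ 2 / (1 + x ^ 2) := by
  have h := (integrable_rpow_neg_one_add_norm_sq (E := ℝ) (μ := volume) (r := 3 / 2)
    (by simp; norm_num)).const_mul 64
  refine h.mono' ?_ (Eventually.of_forall fun x => ?_)
  · refine Continuous.aestronglyMeasurable ?_
    refine (aux_cont.pow 2).div (by fun_prop) ?_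
    intro x; have := aux_u x; linarith
  · have hu := aux_u x
    have hu0 : (0:ℝ) < 1 + x ^ 2 := by linarith
    have hL := aux_L x
    rw [Real.norm_of_nonneg (by positivity)]
    have h1 := Real.log_le_rpow_div hu0.le (ε := 1 / 8) (by norm_num)
    have h2 : (Real.log (1 + x ^ 2)) ^ 2 ≤ 64 * (1 + x ^ 2) ^ (1 / 4 : ℝ) := by
      calc (Real.log (1 + x ^ 2)) ^ 2 ≤ ((1 + x ^ 2) ^ (1 / 8 : ℝ) / (1 / 8)) ^ 2 := by gcongr
        _ = 64 * ((1 + x ^ 2) ^ (1 / 8 : ℝ)) ^ (2:ℕ) := by ring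
        _ = _ := by rw [← Real.rpow_natCast, ← Real.rpow_mul hu0.le]; norm_num
    have h3 : (1 + ‖x‖ ^ 2) ^ (-(3 / 2) / 2 : ℝ) = (1 + x ^ 2) ^ (1 / 4 : ℝ) / (1 + x ^ 2) := by
      rw [Real.norm_eq_abs, sq_abs, ← Real.rpow_sub_one hu0.ne']; norm_num
    rw [h3, ← mul_div_assoc]
    gcongr

lemma int1 : Integrable fun x : ℝ => Real.log (1 + x ^ 2) / (1 + x ^ 2) := by
  refine (int0.add int2).mono' ?_ (Eventually.of_forall fun x => ?_)
  · refine Continuous.aestronglyMeasurable ?_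
    refine aux_cont.div (by fun_prop) ?_
    intro x; have := aux_u x; linarith
  · have hu := aux_u x
    have hu0 : (0:ℝ) < 1 + x ^ 2 := by linarith
    have hL := aux_L x
    rw [Real.norm_of_nonneg (by positivity)]
    simp only [Pi.add_apply]
    rw [← add_div]
    gcongr
    nlinarith [sq_nonneg (Real.log (1 + x ^ 2) - 1)]

lemma cov (g : ℝ → ℝ) :
    (∫ x : ℝ, g x / (1 + x ^ 2)) = ∫ t in Ioo (-(π / 2)) (π / 2), g (Real.tan t) := by
  have h := integral_image_eq_integral_abs_deriv_smul (s := Ioo (-(π / 2)) (π / 2))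
    (f := Real.tan) (f' := fun x => 1 / Real.cos x ^ 2) measurableSet_Ioo
    (fun x hx => (Real.hasDerivAt_tan_of_mem_Ioo hx).hasDerivWithinAt) Real.injOn_tan
    (fun x => g x / (1 + x ^ 2))
  rw [Real.image_tan_Ioo, setIntegral_univ] at h
  rw [h]
  refine setIntegral_congr_fun measurableSet_Ioo fun t ht => ?_
  have hc := (Real.cos_pos_of_mem_Ioo ht)
  simp only [smul_eq_mul]
  rw [abs_of_pos (by positivity)]
  rw [div_eq_mul_inv (g _), Real.inv_one_add_tan_sq hc.ne']
  field_simp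

lemma covI (g : ℝ → ℝ) (hg : Integrable fun x => g x / (1 + x ^ 2)) :
    IntegrableOn (fun t => g (Real.tan t)) (Ioo (-(π / 2)) (π / 2)) := by
  have h := integrableOn_image_iff_integrableOn_abs_deriv_smul (s := Ioo (-(π / 2)) (π / 2))
    (f := Real.tan) (f' := fun x => 1 / Real.cos x ^ 2) measurableSet_Ioo
    (fun x hx => (Real.hasDerivAt_tan_of_mem_Ioo hx).hasDerivWithinAt) Real.injOn_tan
    (fun x => g x / (1 + x ^ 2))
  rw [Real.image_tan_Ioo, integrableOn_univ] at h
  refine (h.1 hg).congr_fun (fun t ht => ?_) measurableSet_Ioo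
  have hc := (Real.cos_pos_of_mem_Ioo ht)
  simp only [smul_eq_mul]
  rw [abs_of_pos (by positivity)]
  rw [div_eq_mul_inv (g _), Real.inv_one_add_tan_sq hc.ne']
  field_simp

lemma circ (r : ℝ) (h0 : 0 ≤ r) (h1 : r < 1) (k : ℕ) (hk : k ≠ 0) :
    (∫ t in Ioo (-(π / 2)) (π / 2),
      (Complex.log (1 + r * Complex.exp (2 * t * Complex.I))) ^ k) = 0 := by
  have hd : DiffContOnCl ℂ (fun z : ℂ => (Complex.log (1 + z)) ^ k) (Metric.ball 0 |r|) := by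
    apply DifferentiableOn.diffContOnCl
    intro z hz
    have hz' : ‖z‖ < 1 := by
      have := Metric.closure_ball_subset_closedBall hz
      rw [mem_closedBall_zero_iff, abs_of_nonneg h0] at this
      linarith
    have hs : 1 + z ∈ Complex.slitPlane := by
      left
      have := Complex.abs_re_le_norm z
      have := neg_abs_le z.re
      simp; linarith
    apply DifferentiableAt.differentiableWithinAt
    exact ((differentiableAt_id.const_add 1).clog hs).pow k
  have h := hd.circleAverage
  rw [Real.circleAverage_eq_integral_add (-π)] at h
  simp only [add_zero, Complex.log_one, zero_pow hk, smul_eq_zero, inv_eq_zero] at h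
  have h' := h.resolve_left (by positivity)
  rw [intervalIntegral.integral_comp_add_right (fun θ => (Complex.log (1 + circleMap 0 r θ)) ^ k)]
    at h'
  have h2 := intervalIntegral.integral_comp_mul_left (a := -(π / 2)) (b := π / 2)
    (fun θ => (Complex.log (1 + circleMap 0 r θ)) ^ k) (c := 2) (by norm_num)
  rw [show (2:ℝ) * -(π / 2) = 0 + -π by ring, show (2:ℝ) * (π / 2) = 2 * π + -π by ring, h',
    smul_zero, intervalIntegral.integral_of_le (by linarith [Real.pi_pos]),
    integral_Ioc_eq_integral_Ioo] at h2
  rw [← h2]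
  refine setIntegral_congr_fun measurableSet_Ioo fun t ht => ?_
  simp [circleMap]

lemma logcos (t : ℝ) (ht : t ∈ Ioo (-(π / 2)) (π / 2)) :
    Real.log (Real.cos t) = - Real.log (1 + Real.tan t ^ 2) / 2 := by
  have hc := Real.cos_pos_of_mem_Ioo ht
  have := Real.inv_one_add_tan_sq hc.ne'
  have h2 : Real.log ((1 + Real.tan t ^ 2)⁻¹) = Real.log (Real.cos t ^ 2) := by rw [this]
  rw [Real.log_inv, Real.log_pow] at h2
  push_cast at h2
  linarith

lemma normsq (r t : ℝ) : ‖1 + (r:ℂ) * Complex.exp (2 * t * Complex.I)‖ ^ 2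
    = (1 - r) ^ 2 + 4 * r * Real.cos t ^ 2 := by
  rw [← Complex.normSq_eq_norm_sq, Complex.normSq_apply]
  have : (2 * (t:ℂ)) = ((2 * t : ℝ) : ℂ) := by push_cast; ring
  rw [this]
  have hre := Complex.exp_ofReal_mul_I_re (2 * t)
  have him := Complex.exp_ofReal_mul_I_im (2 * t)
  simp only [Complex.add_re, Complex.add_im, Complex.one_re, Complex.one_im, Complex.re_ofReal_mul,
    Complex.im_ofReal_mul, hre, him]
  have h1 := Real.sin_sq_add_cos_sq (2 * t)
  have h2 := Real.cos_two_mul t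
  linear_combination r ^ 2 * h1 + 2 * r * h2

lemma bnd (r t : ℝ) (h0 : 1 / 2 ≤ r) (h1 : r < 1) (ht : t ∈ Ioo (-(π / 2)) (π / 2)) :
    ‖Complex.log (1 + r * Complex.exp (2 * t * Complex.I))‖
      ≤ Real.log (1 + Real.tan t ^ 2) / 2 + Real.log 2 + π := by
  refine (Complex.norm_le_abs_re_add_abs_im _).trans ?_
  rw [Complex.log_re, Complex.log_im]
  have ha := Complex.abs_arg_le_pi (1 + r * Complex.exp (2 * t * Complex.I))
  have hc := Real.cos_pos_of_mem_Ioo ht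
  have hc1 := Real.cos_le_one t
  have hn := normsq r t
  have hlc := logcos t ht
  have hLp := aux_L (Real.tan t)
  set n := ‖1 + (r:ℂ) * Complex.exp (2 * t * Complex.I)‖ with hnn
  have hn0 : 0 ≤ n := norm_nonneg _
  have l1 : Real.cos t ≤ n := by
    refine (pow_le_pow_iff_left₀ hc.le hn0 two_ne_zero).1 ?_
    rw [hn]; nlinarith [sq_nonneg (1 - r), sq_nonneg (Real.cos t)]
  have l2 : n ≤ 2 := by
    refine (pow_le_pow_iff_left₀ hn0 (by norm_num) two_ne_zero).1 ?_
    rw [hn]; nlinarith [sq_nonneg (1 - r), sq_nonneg (Real.cos t)]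
  have g1 := Real.log_le_log hc l1
  have g2 := Real.log_le_log (hc.trans_le l1) l2
  have g3 : 0 ≤ Real.log 2 := Real.log_nonneg (by norm_num)
  have : |Real.log n| ≤ Real.log (1 + Real.tan t ^ 2) / 2 + Real.log 2 := by
    rw [abs_le]; constructor <;> linarith
  linarith

lemma bndI : IntegrableOn (fun t => (Real.log (1 + Real.tan t ^ 2) / 2 + Real.log 2 + π) ^ 2)
    (Ioo (-(π / 2)) (π / 2)) := by
  apply covI (fun x => (Real.log (1 + x ^ 2) / 2 + Real.log 2 + π) ^ 2)
  have := ((int2.const_mul (1/4)).add (int1.const_mul (Real.log 2 + π))).add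
    (int0.const_mul ((Real.log 2 + π) ^ 2))
  refine this.congr (Eventually.of_forall fun x => ?_)
  simp only [Pi.add_apply]
  ring

lemma loglim (t : ℝ) (ht : t ∈ Ioo (-(π / 2)) (π / 2)) :
    Tendsto (fun r : ℝ => Complex.log (1 + r * Complex.exp (2 * t * Complex.I))) (𝓝[<] 1)
      (𝓝 ((Real.log 2 - Real.log (1 + Real.tan t ^ 2) / 2 : ℝ) + t * Complex.I)) := by
  have hc := Real.cos_pos_of_mem_Ioo ht
  have e : 1 + Complex.exp (2 * t * Complex.I)
      = ((2 * Real.cos t : ℝ) : ℂ) * Complex.exp (t * Complex.I) := by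
    push_cast
    rw [Complex.cos, mul_div_cancel₀ _ (by norm_num), add_mul, ← Complex.exp_add,
      ← Complex.exp_add]
    ring_nf
    simp [add_comm]
  have hl : Complex.log (1 + Complex.exp (2 * t * Complex.I))
      = ((Real.log 2 - Real.log (1 + Real.tan t ^ 2) / 2 : ℝ) + t * Complex.I) := by
    rw [e, Complex.log_ofReal_mul (by positivity) (Complex.exp_ne_zero _), Complex.log_exp,
      Real.log_mul (by norm_num) hc.ne', logcos t ht]
    · congr 2; ring
    · simp; linarith [ht.1, Real.pi_pos]
    · simp; linarith [ht.2, Real.pi_pos]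
  rw [← hl]
  apply Tendsto.mono_left _ nhdsWithin_le_nhds
  have hs : 1 + ((1:ℝ):ℂ) * Complex.exp (2 * t * Complex.I) ∈ Complex.slitPlane := by
    left
    rw [Complex.ofReal_one, one_mul, e, Complex.re_ofReal_mul, Complex.exp_ofReal_mul_I_re]
    positivity
  have : ContinuousAt (fun r : ℝ => Complex.log (1 + r * Complex.exp (2 * t * Complex.I))) 1 := by
    refine ContinuousAt.clog (f := fun r : ℝ => 1 + (r:ℂ) * Complex.exp (2 * t * Complex.I)) ?_ hs
    fun_prop
  simpa [ContinuousAt] using this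

lemma base (k : ℕ) (hk : k ≠ 0) (hk2 : k ≤ 2) :
    (∫ t in Ioo (-(π / 2)) (π / 2),
     (((Real.log 2 - Real.log (1 + Real.tan t ^ 2) / 2 : ℝ) + t * Complex.I : ℂ)) ^ k) = 0 := by
  have ev : ∀ᶠ r : ℝ in 𝓝[<] 1, 1 / 2 ≤ r ∧ r < 1 := by
    filter_upwards [Ioo_mem_nhdsLT (show (1/2:ℝ) < 1 by norm_num)] with r hr
    exact ⟨hr.1.le, hr.2⟩
  have h := tendsto_integral_filter_of_dominated_convergence
    (μ := volume.restrict (Ioo (-(π / 2)) (π / 2))) (l := 𝓝[<] (1:ℝ))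
    (F := fun (r : ℝ) (t : ℝ) => (Complex.log (1 + r * Complex.exp (2 * t * Complex.I))) ^ k)
    (f := fun t => (((Real.log 2 - Real.log (1 + Real.tan t ^ 2) / 2 : ℝ) + t * Complex.I : ℂ)) ^ k)
    (fun t => (Real.log (1 + Real.tan t ^ 2) / 2 + Real.log 2 + π) ^ 2) ?_ ?_ bndI ?_
  · refine tendsto_nhds_unique h ?_
    refine tendsto_const_nhds.congr' ?_
    filter_upwards [ev] with r hr
    exact (circ r (by linarith [hr.1]) hr.2 k hk).symm
  · refine Eventually.of_forall fun r => ?_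
    apply Measurable.aestronglyMeasurable
    fun_prop
  · filter_upwards [ev] with r hr
    refine (ae_restrict_iff' measurableSet_Ioo).2 (Eventually.of_forall fun t ht => ?_)
    have hb := bnd r t hr.1 hr.2 ht
    rw [norm_pow]
    refine (pow_le_pow_left₀ (norm_nonneg _) hb k).trans ?_
    apply pow_le_pow_right₀ _ hk2
    have := aux_L (Real.tan t)
    have : 0 ≤ Real.log 2 := Real.log_nonneg (by norm_num)
    linarith [Real.pi_gt_three]
  · refine (ae_restrict_iff' measurableSet_Ioo).2 (Eventually.of_forall fun t ht => ?_)
    exact (loglim t ht).pow k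

lemma I0 : (∫ x : ℝ, 1 / (1 + x ^ 2)) = π := by simp

lemma base' (k : ℕ) (hk : k ≠ 0) (hk2 : k ≤ 2) :
    (∫ t in Ioo (-(π / 2)) (π / 2),
     ((((Real.log 2 - Real.log (1 + Real.tan t ^ 2) / 2 : ℝ) + t * Complex.I : ℂ)) ^ k).re) = 0 := by
  have hi : Integrable (fun t : ℝ =>
      (((Real.log 2 - Real.log (1 + Real.tan t ^ 2) / 2 : ℝ) + t * Complex.I : ℂ)) ^ k)
      (volume.restrict (Ioo (-(π / 2)) (π / 2))) := by
    refine bndI.mono' ?_ ?_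
    · apply Measurable.aestronglyMeasurable
      have : Measurable Real.tan := by
        have : Real.tan = fun x => Real.sin x / Real.cos x := by
          ext x; exact Real.tan_eq_sin_div_cos x
        rw [this]; fun_prop
      fun_prop
    · refine (ae_restrict_iff' measurableSet_Ioo).2 (Eventually.of_forall fun t ht => ?_)
      have h1 := ((loglim t ht).pow k).norm
      refine le_of_tendsto h1 ?_
      filter_upwards [Ioo_mem_nhdsLT (show (1/2:ℝ) < 1 by norm_num)] with r hr
      have hb := bnd r t hr.1.le hr.2 ht
      rw [norm_pow]
      refine (pow_le_pow_left₀ (norm_nonneg _) hb k).trans ?_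
      apply pow_le_pow_right₀ _ hk2
      have := aux_L (Real.tan t)
      have : 0 ≤ Real.log 2 := Real.log_nonneg (by norm_num)
      linarith [Real.pi_gt_three]
  have h := integral_re (𝕜 := ℂ) hi
  simp only [RCLike.re_to_complex] at h
  rw [h, base k hk hk2]
  simp

lemma I1 : (∫ x : ℝ, Real.log (1 + x ^ 2) / (1 + x ^ 2)) = 2 * π * Real.log 2 := by
  have h := base' 1 one_ne_zero (by norm_num)
  simp only [pow_one, Complex.add_re, Complex.ofReal_re, Complex.mul_I_re, Complex.ofReal_im,
    neg_zero, add_zero] at h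
  rw [← cov (fun x => Real.log 2 - Real.log (1 + x ^ 2) / 2)] at h
  have e : (∫ x : ℝ, (Real.log 2 - Real.log (1 + x ^ 2) / 2) / (1 + x ^ 2))
      = Real.log 2 * (∫ x : ℝ, 1 / (1 + x ^ 2))
        - (1 / 2) * ∫ x : ℝ, Real.log (1 + x ^ 2) / (1 + x ^ 2) := by
    rw [← integral_const_mul, ← integral_const_mul,
      ← integral_sub (int0.const_mul _) (int1.const_mul _)]
    congr 1; ext x; ring
  rw [e, I0] at h
  linarith

lemma I2 : (∫ x : ℝ, (Real.log (1 + x ^ 2)) ^ 2 / (1 + x ^ 2))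
    = π * (4 * Real.log 2 ^ 2 + π ^ 2 / 3) := by
  have h := base' 2 two_ne_zero (by norm_num)
  have e0 : ∀ t : ℝ, ((((Real.log 2 - Real.log (1 + Real.tan t ^ 2) / 2 : ℝ)
      + t * Complex.I : ℂ)) ^ 2).re
      = (Real.log 2 - Real.log (1 + Real.tan t ^ 2) / 2) ^ 2 - t ^ 2 := by
    intro t
    rw [pow_two, Complex.mul_re]
    simp only [Complex.add_re, Complex.ofReal_re, Complex.mul_I_re, Complex.ofReal_im,
      Complex.add_im, Complex.mul_I_im]
    ring
  simp only [e0] at h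
  have hint : Integrable (fun x : ℝ =>
      (Real.log 2 - Real.log (1 + x ^ 2) / 2) ^ 2 / (1 + x ^ 2)) := by
    refine (((int0.const_mul (Real.log 2 ^ 2)).sub (int1.const_mul (Real.log 2))).add
      (int2.const_mul (1 / 4))).congr (Eventually.of_forall fun x => ?_)
    simp only [Pi.add_apply, Pi.sub_apply]
    ring
  have hi2 : IntegrableOn (fun t : ℝ => t ^ 2) (Ioo (-(π / 2)) (π / 2)) :=
    ((continuous_pow 2).integrableOn_Icc).mono_set Ioo_subset_Icc_self
  rw [integral_sub (covI (fun x => (Real.log 2 - Real.log (1 + x ^ 2) / 2) ^ 2) hint) hi2,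
    ← cov (fun x => (Real.log 2 - Real.log (1 + x ^ 2) / 2) ^ 2)] at h
  have e1 : (∫ t in Ioo (-(π / 2)) (π / 2), t ^ 2) = π ^ 3 / 12 := by
    rw [← integral_Ioc_eq_integral_Ioo,
      ← intervalIntegral.integral_of_le (by linarith [Real.pi_pos]), integral_pow]
    push_cast
    ring
  have e : (∫ x : ℝ, (Real.log 2 - Real.log (1 + x ^ 2) / 2) ^ 2 / (1 + x ^ 2))
      = Real.log 2 ^ 2 * (∫ x : ℝ, 1 / (1 + x ^ 2))
        - Real.log 2 * (∫ x : ℝ, Real.log (1 + x ^ 2) / (1 + x ^ 2))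
        + (1 / 4) * ∫ x : ℝ, (Real.log (1 + x ^ 2)) ^ 2 / (1 + x ^ 2) := by
    have hA : Integrable (fun x : ℝ => Real.log 2 ^ 2 * (1 / (1 + x ^ 2))
        - Real.log 2 * (Real.log (1 + x ^ 2) / (1 + x ^ 2))) :=
      (int0.const_mul _).sub (int1.const_mul _)
    rw [← integral_const_mul, ← integral_const_mul, ← integral_const_mul,
      ← integral_sub (int0.const_mul _) (int1.const_mul _),
      ← integral_add hA (int2.const_mul _)]
    congr 1; ext x; ring
  rw [e, e1, I0, I1] at h
  linarith

lemma xlim (l : Filter ℝ) (hl : Tendsto (fun x : ℝ => 1 + x ^ 2) l atTop) (k : ℕ) :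
    Tendsto (fun x : ℝ => x / (1 + x ^ 2) * (Real.log (1 + x ^ 2)) ^ k) l (𝓝 0) := by
  have h := (Real.tendsto_pow_log_div_mul_add_atTop 1 0 (2 * k) one_ne_zero).comp hl
  have h2 := h.sqrt
  rw [Real.sqrt_zero] at h2
  refine squeeze_zero_norm (fun x => ?_) h2
  have hu := aux_u x
  have hu0 : (0:ℝ) < 1 + x ^ 2 := by linarith
  apply Real.le_sqrt_of_sq_le
  rw [Real.norm_eq_abs, sq_abs]
  simp only [Function.comp, one_mul, add_zero]
  rw [mul_pow, ← pow_mul, mul_comm k 2, mul_comm,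
    div_eq_mul_inv (Real.log (1 + x ^ 2) ^ (2 * k))]
  have hL := aux_L x
  apply mul_le_mul_of_nonneg_left _ (by positivity)
  rw [div_pow, div_le_iff₀ (by positivity)]
  field_simp
  linarith

noncomputable def AA (x : ℝ) : ℝ :=
  x / (1 + x ^ 2) * (Real.log (1 + x ^ 2)) ^ 2
      * (1 / 4 - 1 / 6 * (1 + x ^ 2)⁻¹ + 2 / 3 * ((1 + x ^ 2)⁻¹) ^ 2)
  + x / (1 + x ^ 2) * (Real.log (1 + x ^ 2)) ^ 1
      * (5 / 12 - 5 / 18 * (1 + x ^ 2)⁻¹ + 4 / 9 * ((1 + x ^ 2)⁻¹) ^ 2)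
  + x / (1 + x ^ 2) * (Real.log (1 + x ^ 2)) ^ 0
      * (31 / 72 - 19 / 108 * (1 + x ^ 2)⁻¹ + 4 / 27 * ((1 + x ^ 2)⁻¹) ^ 2)

lemma AAlim (l : Filter ℝ) (hl : Tendsto (fun x : ℝ => 1 + x ^ 2) l atTop) :
    Tendsto AA l (𝓝 0) := by
  have hi := tendsto_inv_atTop_zero.comp hl
  have hp : ∀ a b c : ℝ, Tendsto (fun x : ℝ => a - b * (1 + x ^ 2)⁻¹ + c * ((1 + x ^ 2)⁻¹) ^ 2) l
      (𝓝 (a - b * 0 + c * 0 ^ 2)) := fun a b c =>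
    (tendsto_const_nhds.sub (tendsto_const_nhds.mul hi)).add (tendsto_const_nhds.mul (hi.pow 2))
  have := (((xlim l hl 2).mul (hp (1/4) (1/6) (2/3))).add
    ((xlim l hl 1).mul (hp (5/12) (5/18) (4/9)))).add
    ((xlim l hl 0).mul (hp (31/72) (19/108) (4/27)))
  simp only [zero_mul, add_zero] at this
  exact this

noncomputable def GG (x : ℝ) : ℝ :=
  (Real.log (1 + x ^ 2)) ^ 2 * (1 - x ^ 2) ^ 2 / (1 + x ^ 2) ^ 4
    - ((1 / 4) * ((Real.log (1 + x ^ 2)) ^ 2 / (1 + x ^ 2))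
      + (-7 / 12) * (Real.log (1 + x ^ 2) / (1 + x ^ 2)) + (-29 / 72) * (1 / (1 + x ^ 2)))

lemma hasD (x : ℝ) : HasDerivAt AA (GG x) x := by
  have hu0 : 1 + x ^ 2 ≠ 0 := by have := aux_u x; linarith
  have hu : HasDerivAt (fun x : ℝ => 1 + x ^ 2) (2 * x) x := by
    simpa using (hasDerivAt_pow 2 x).const_add 1
  have hL := hu.log hu0
  have hi := hu.inv hu0
  have hx := (hasDerivAt_id x).div hu hu0
  have hp : ∀ a b c : ℝ, HasDerivAt (fun x : ℝ => a - b * (1 + x ^ 2)⁻¹ + c * ((1 + x ^ 2)⁻¹) ^ 2) _ x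
    := fun a b c => ((hi.const_mul b).const_sub a).add ((hi.pow 2).const_mul c)
  have := (((hx.mul (hL.pow 2)).mul (hp (1/4) (1/6) (2/3))).add
    ((hx.mul (hL.pow 1)).mul (hp (5/12) (5/18) (4/9)))).add
    ((hx.mul (hL.pow 0)).mul (hp (31/72) (19/108) (4/27)))
  refine HasDerivAt.congr_deriv (f := AA) this ?_
  simp only [GG, id, Pi.mul_apply, Pi.pow_apply, Pi.div_apply, Pi.inv_apply]
  generalize Real.log (1 + x ^ 2) = L
  push_cast
  simp only [pow_zero]
  field_simp
  ring

lemma intM : Integrable fun x : ℝ =>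
    (Real.log (1 + x ^ 2)) ^ 2 * (1 - x ^ 2) ^ 2 / (1 + x ^ 2) ^ 4 := by
  refine int2.mono' ?_ (Eventually.of_forall fun x => ?_)
  · refine Continuous.aestronglyMeasurable ?_
    refine ((aux_cont.pow 2).mul (by fun_prop)).div (by fun_prop) ?_
    intro x; have := aux_u x; positivity
  · have hu := aux_u x
    have hu0 : (0:ℝ) < 1 + x ^ 2 := by linarith
    rw [Real.norm_of_nonneg (by positivity), div_le_div_iff₀ (by positivity) hu0]
    have h1 : (1 - x ^ 2) ^ 2 ≤ (1 + x ^ 2) ^ 2 := by nlinarith [sq_nonneg x]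
    have h2 : (1 + x ^ 2) ^ 2 ≤ (1 + x ^ 2) ^ 3 := pow_le_pow_right₀ hu (by norm_num)
    calc _ ≤ (Real.log (1 + x ^ 2)) ^ 2 * (1 + x ^ 2) ^ 3 * (1 + x ^ 2) := by
          gcongr; exact h1.trans h2
      _ = _ := by ring

lemma main : 12 * (∫ x : ℝ, (Real.log (1 + x ^ 2)) ^ 2 * (1 - x ^ 2) ^ 2 / (1 + x ^ 2) ^ 4)
      = -(29 / 6) * Real.pi + Real.pi ^ 3 + Real.pi * Real.log 4 * (Real.log 64 - 7) := by
  have hR := ((int2.const_mul (1 / 4)).add (int1.const_mul (-7 / 12))).add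
    (int0.const_mul (-29 / 72))
  have hG : Integrable GG := intM.sub hR
  have t : Tendsto (fun x : ℝ => x ^ 2) atBot atTop :=
    by
    simpa [Function.comp_def] using (tendsto_pow_atTop (α := ℝ) two_ne_zero).comp tendsto_neg_atBot_atTop
  have h := integral_of_hasDerivAt_of_tendsto hasD hG
    (AAlim atBot (tendsto_atTop_add_const_left _ _ t))
    (AAlim atTop (tendsto_atTop_add_const_left _ _ (tendsto_pow_atTop two_ne_zero)))
  have e : (∫ x, GG x) = (∫ x : ℝ, (Real.log (1 + x ^ 2)) ^ 2 * (1 - x ^ 2) ^ 2 / (1 + x ^ 2) ^ 4)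
      - ((1 / 4) * (∫ x : ℝ, (Real.log (1 + x ^ 2)) ^ 2 / (1 + x ^ 2))
      + (-7 / 12) * (∫ x : ℝ, Real.log (1 + x ^ 2) / (1 + x ^ 2))
      + (-29 / 72) * ∫ x : ℝ, 1 / (1 + x ^ 2)) := by
    have hA : Integrable (fun x : ℝ => (1 / 4) * ((Real.log (1 + x ^ 2)) ^ 2 / (1 + x ^ 2))
      + (-7 / 12) * (Real.log (1 + x ^ 2) / (1 + x ^ 2))) :=
      (int2.const_mul _).add (int1.const_mul _)
    have hB : Integrable (fun x : ℝ => (1 / 4) * ((Real.log (1 + x ^ 2)) ^ 2 / (1 + x ^ 2))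
      + (-7 / 12) * (Real.log (1 + x ^ 2) / (1 + x ^ 2)) + (-29 / 72) * (1 / (1 + x ^ 2))) := hR
    rw [← integral_const_mul, ← integral_const_mul, ← integral_const_mul,
      ← integral_add (int2.const_mul _) (int1.const_mul _),
      ← integral_add hA (int0.const_mul _), ← integral_sub intM hB]
    rfl
  rw [e, I0, I1, I2] at h
  have l4 : Real.log 4 = 2 * Real.log 2 := by
    rw [show (4:ℝ) = 2 ^ 2 by norm_num, Real.log_pow]; norm_num
  have l64 : Real.log 64 = 6 * Real.log 2 := by
    rw [show (64:ℝ) = 2 ^ 6 by norm_num, Real.log_pow]; norm_num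
  rw [l4, l64]
  linear_combination 12 * h

lemma d2 (x : ℝ) : iteratedDeriv 2 (fun y : ℝ => Real.log (1 + y ^ 2)) x
    = 2 * (1 - x ^ 2) / (1 + x ^ 2) ^ 2 := by
  have hu0 : ∀ x : ℝ, 1 + x ^ 2 ≠ 0 := fun x => by have := aux_u x; linarith
  have hu : ∀ x : ℝ, HasDerivAt (fun x : ℝ => 1 + x ^ 2) (2 * x) x := fun x => by
    simpa using (hasDerivAt_pow 2 x).const_add 1
  have h1 : deriv (fun y : ℝ => Real.log (1 + y ^ 2)) = fun x => 2 * x / (1 + x ^ 2) := by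
    ext x; exact ((hu x).log (hu0 x)).deriv
  rw [iteratedDeriv_succ, iteratedDeriv_one, h1]
  have := (((hasDerivAt_id x).const_mul 2).div (hu x) (hu0 x)).deriv
  refine Eq.trans this ?_
  simp only [id]
  ring


theorem stmt_3 :
    12 * (∫ x : ℝ, (Real.log (1 + x ^ 2)) ^ 2 * (1 - x ^ 2) ^ 2 / (1 + x ^ 2) ^ 4)
      = -(29 / 6) * Real.pi + Real.pi ^ 3 + Real.pi * Real.log 4 * (Real.log 64 - 7) ∧
    3 * (∫ x : ℝ, (Real.log (1 + x ^ 2)) ^ 2 *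
        (iteratedDeriv 2 (fun y : ℝ => Real.log (1 + y ^ 2)) x) ^ 2)
      = -(29 / 6) * Real.pi + Real.pi ^ 3 + Real.pi * Real.log 4 * (Real.log 64 - 7) := by
  refine ⟨main, ?_⟩
  have e : (fun x : ℝ => (Real.log (1 + x ^ 2)) ^ 2 *
        (iteratedDeriv 2 (fun y : ℝ => Real.log (1 + y ^ 2)) x) ^ 2)
      = fun x : ℝ => 4 * ((Real.log (1 + x ^ 2)) ^ 2 * (1 - x ^ 2) ^ 2 / (1 + x ^ 2) ^ 4) := by
    ext x
    rw [d2]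
    have : 1 + x ^ 2 ≠ 0 := by have := aux_u x; linarith
    field_simp
    ring
  rw [e, integral_const_mul, ← main]
  ring
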